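/- ILC is a conservative extension of LLJ: every sequent provable in LLJ is provable in ILC (after replacing the up-linear implication rules by the pair of ¬ and ⅋ rules), and conversely, if a sequent Δ ⊢ Γ all of whose formulas belong to the language of ILL (generated by propositional variables, ⊤, ⊗, &, ⊕, up-linear implication, and !) is provable in ILC, then Γ is empty or a single formula B, and Δ ⊢ Γ is provable in LLJ. -/

import Mathlib

set_option autoImplicit true

/-- Formulas of intuitionistic linear logic extended (ILL^e). -/
inductive LF : Type
  | var : ℕ → LF
  | top : LF
  | bot : LF
  | one : LF
  | zero : LF
  | tensor : LF → LF → LF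
  | par : LF → LF → LF
  | withc : LF → LF → LF
  | plus : LF → LF → LF
  | neg : LF → LF
  | ofc : LF → LF
  | wn : LF → LF

/-- `ILC c w Δ Γ` : the sequent `Δ ⊢ Γ` is provable, where the flag `c`
permits the Cut rule and the flag `w` permits the two weakly distributive
rules.  Thus `ILC true false` is provability in ILC and `ILC true true` is
provability in ILC_ι. -/
inductive ILC : Bool → Bool → List LF → List LF → Prop
  | xl : ILC c w (Δ ++ A :: A' :: Δ') Γ → ILC c w (Δ ++ A' :: A :: Δ') Γ
  | xr : ILC c w Δ (Γ ++ B :: B' :: Γ') → ILC c w Δ (Γ ++ B' :: B :: Γ')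
  | ocW : ILC c w Δ Γ → ILC c w (Δ ++ [LF.ofc A]) Γ
  | wnW : ILC c w Δ Γ → ILC c w Δ (LF.wn B :: Γ)
  | ocC : ILC c w (Δ ++ [LF.ofc A, LF.ofc A]) Γ → ILC c w (Δ ++ [LF.ofc A]) Γ
  | wnC : ILC c w Δ (LF.wn B :: LF.wn B :: Γ) → ILC c w Δ (LF.wn B :: Γ)
  | ocD : ILC c w (Δ ++ [A]) Γ → ILC c w (Δ ++ [LF.ofc A]) Γ
  | wnD : ILC c w Δ (B :: Γ) → ILC c w Δ (LF.wn B :: Γ)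
  | wnL : ILC c w (List.map LF.ofc Δ ++ [A]) (List.map LF.wn Γ) →
      ILC c w (List.map LF.ofc Δ ++ [LF.wn A]) (List.map LF.wn Γ)
  | ocR : ILC c w (List.map LF.ofc Δ) (B :: List.map LF.wn Γ) →
      ILC c w (List.map LF.ofc Δ) (LF.ofc B :: List.map LF.wn Γ)
  | id : ILC c w [A] [A]
  | cut : ILC true w Δ (B :: Γ) → ILC true w (Δ' ++ [B]) Γ' →
      ILC true w (Δ ++ Δ') (Γ ++ Γ')
  | oneR : ILC c w Δ (LF.one :: Γ)
  | zeroL : ILC c w (Δ ++ [LF.zero]) Γ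
  | topL : ILC c w Δ Γ → ILC c w (Δ ++ [LF.top]) Γ
  | topR : ILC c w [] [LF.top]
  | botL : ILC c w [LF.bot] []
  | botR : ILC c w Δ Γ → ILC c w Δ (LF.bot :: Γ)
  | tensorL : ILC c w (Δ ++ [A₁, A₂]) Γ → ILC c w (Δ ++ [LF.tensor A₁ A₂]) Γ
  | tensorR : ILC c w Δ₁ (B₁ :: Γ₁) → ILC c w Δ₂ (B₂ :: Γ₂) →
      ILC c w (Δ₁ ++ Δ₂) (LF.tensor B₁ B₂ :: (Γ₁ ++ Γ₂))
  | withL₁ : ILC c w (Δ ++ [A₁]) Γ → ILC c w (Δ ++ [LF.withc A₁ A₂]) Γ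
  | withL₂ : ILC c w (Δ ++ [A₂]) Γ → ILC c w (Δ ++ [LF.withc A₁ A₂]) Γ
  | withR : ILC c w Δ (B₁ :: Γ) → ILC c w Δ (B₂ :: Γ) → ILC c w Δ (LF.withc B₁ B₂ :: Γ)
  | parL : ILC c w (Δ₁ ++ [A₁]) Γ₁ → ILC c w (Δ₂ ++ [A₂]) Γ₂ →
      ILC c w (Δ₁ ++ Δ₂ ++ [LF.par A₁ A₂]) (Γ₁ ++ Γ₂)
  | parR : ILC c w Δ (B₁ :: B₂ :: Γ) → ILC c w Δ (LF.par B₁ B₂ :: Γ)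
  | plusL : ILC c w (Δ ++ [A₁]) Γ → ILC c w (Δ ++ [A₂]) Γ → ILC c w (Δ ++ [LF.plus A₁ A₂]) Γ
  | plusR₁ : ILC c w Δ (B₁ :: Γ) → ILC c w Δ (LF.plus B₁ B₂ :: Γ)
  | plusR₂ : ILC c w Δ (B₂ :: Γ) → ILC c w Δ (LF.plus B₁ B₂ :: Γ)
  | negL : ILC c w Δ (B :: Γ) → ILC c w (Δ ++ [LF.neg B]) Γ
  | negR : ILC c w (Δ ++ [A]) Γ → ILC c w Δ (LF.neg A :: Γ)
  | ocwnL : ILC c true (List.map LF.ofc Δ ++ [LF.ofc A]) (List.map LF.wn Γ) →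
      ILC c true (List.map LF.ofc Δ ++ [LF.ofc (LF.wn A)]) (List.map LF.wn Γ)
  | wnocR : ILC c true (List.map LF.ofc Δ) (LF.wn B :: List.map LF.wn Γ) →
      ILC c true (List.map LF.ofc Δ) (LF.wn (LF.ofc B) :: List.map LF.wn Γ)

/-- The formulas of ILL, as a subset of the formulas of ILL^e: generated by
propositional variables, ⊤, ⊗, &, ⊕, up-linear implication `A ⊸ B := ¬A ⅋ B`,
and `!`. -/
inductive IsILL : LF → Prop
  | var (n : ℕ) : IsILL (LF.var n)
  | top : IsILL LF.top
  | tensor : IsILL A → IsILL B → IsILL (LF.tensor A B)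
  | withc : IsILL A → IsILL B → IsILL (LF.withc A B)
  | plus : IsILL A → IsILL B → IsILL (LF.plus A B)
  | limp : IsILL A → IsILL B → IsILL (LF.par (LF.neg A) B)
  | ofc : IsILL A → IsILL (LF.ofc A)

/-- The intuitionistic sequent calculus LLJ for ILL, with up-linear
implication `A ⊸ B` represented as `¬A ⅋ B`. -/
inductive LLJ : List LF → Option LF → Prop
  | xl : LLJ (Δ ++ A :: A' :: Δ') C → LLJ (Δ ++ A' :: A :: Δ') C
  | id : LLJ [A] (some A)
  | cut : LLJ Δ (some B) → LLJ (Δ' ++ [B]) C → LLJ (Δ ++ Δ') C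
  | topL : LLJ Δ C → LLJ (Δ ++ [LF.top]) C
  | topR : LLJ [] (some LF.top)
  | tensorL : LLJ (Δ ++ [A₁, A₂]) C → LLJ (Δ ++ [LF.tensor A₁ A₂]) C
  | tensorR : LLJ Δ₁ (some B₁) → LLJ Δ₂ (some B₂) →
      LLJ (Δ₁ ++ Δ₂) (some (LF.tensor B₁ B₂))
  | withL₁ : LLJ (Δ ++ [A₁]) C → LLJ (Δ ++ [LF.withc A₁ A₂]) C
  | withL₂ : LLJ (Δ ++ [A₂]) C → LLJ (Δ ++ [LF.withc A₁ A₂]) C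
  | withR : LLJ Δ (some B₁) → LLJ Δ (some B₂) → LLJ Δ (some (LF.withc B₁ B₂))
  | plusL : LLJ (Δ ++ [A₁]) C → LLJ (Δ ++ [A₂]) C → LLJ (Δ ++ [LF.plus A₁ A₂]) C
  | plusR₁ : LLJ Δ (some B₁) → LLJ Δ (some (LF.plus B₁ B₂))
  | plusR₂ : LLJ Δ (some B₂) → LLJ Δ (some (LF.plus B₁ B₂))
  | ocW : LLJ Δ C → LLJ (Δ ++ [LF.ofc A]) C
  | ocC : LLJ (Δ ++ [LF.ofc A, LF.ofc A]) C → LLJ (Δ ++ [LF.ofc A]) C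
  | ocD : LLJ (Δ ++ [A]) C → LLJ (Δ ++ [LF.ofc A]) C
  | ocR : LLJ (List.map LF.ofc Δ) (some B) → LLJ (List.map LF.ofc Δ) (some (LF.ofc B))
  | limpL : LLJ Δ (some A) → LLJ (Γ ++ [B]) C →
      LLJ (Δ ++ Γ ++ [LF.par (LF.neg A) B]) C
  | limpR : LLJ (Δ ++ [A]) (some B) → LLJ Δ (some (LF.par (LF.neg A) B))


open scoped Pointwise

theorem LLJ.perm_aux {l l' : List LF} (h : l.Perm l') :
    ∀ (G : List LF) (C : Option LF), LLJ (G ++ l) C → LLJ (G ++ l') C := by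
  induction h with
  | nil => intro G C h; exact h
  | cons a _ ih =>
    intro G C h
    have := ih (G ++ [a]) C (by simpa using h)
    simpa using this
  | swap a b l => intro G C h; exact LLJ.xl h
  | trans _ _ ih1 ih2 => intro G C h; exact ih2 G C (ih1 G C h)

theorem LLJ.perm {l l' : List LF} {C : Option LF} (h : l.Perm l') (d : LLJ l C) : LLJ l' C := by
  simpa using LLJ.perm_aux h [] C (by simpa using d)

theorem LLJ.to_ilc {Δ : List LF} {C : Option LF} (h : LLJ Δ C) : ILC true false Δ C.toList := by
  induction h with
  | xl _ ih => exact ILC.xl ih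
  | id => exact ILC.id
  | cut _ _ ih1 ih2 => exact ILC.cut (Γ := []) ih1 ih2
  | topL _ ih => exact ILC.topL ih
  | topR => exact ILC.topR
  | tensorL _ ih => exact ILC.tensorL ih
  | tensorR _ _ ih1 ih2 => exact ILC.tensorR (Γ₁ := []) (Γ₂ := []) ih1 ih2
  | withL₁ _ ih => exact ILC.withL₁ ih
  | withL₂ _ ih => exact ILC.withL₂ ih
  | withR _ _ ih1 ih2 => exact ILC.withR ih1 ih2
  | plusL _ _ ih1 ih2 => exact ILC.plusL ih1 ih2
  | plusR₁ _ ih => exact ILC.plusR₁ ih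
  | plusR₂ _ ih => exact ILC.plusR₂ ih
  | ocW _ ih => exact ILC.ocW ih
  | ocC _ ih => exact ILC.ocC ih
  | ocD _ ih => exact ILC.ocD ih
  | ocR _ ih => exact ILC.ocR (Γ := []) ih
  | limpL _ _ ih1 ih2 => exact ILC.parL (Γ₁ := []) (ILC.negL (Γ := []) ih1) ih2
  | limpR _ ih => exact ILC.parR (ILC.negR ih)

/-- LLJ provability with a multiset on the left. -/
def mLLJ (s : Multiset LF) (C : LF) : Prop := ∃ l : List LF, (l : Multiset LF) = s ∧ LLJ l (some C)

theorem mLLJ_coe {l : List LF} {C : LF} : mLLJ (l : Multiset LF) C ↔ LLJ l (some C) := by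
  constructor
  · rintro ⟨l', h, d⟩
    exact d.perm (Multiset.coe_eq_coe.1 h)
  · intro d; exact ⟨l, rfl, d⟩

theorem coe_snoc (l : List LF) (A : LF) : (l : Multiset LF) + {A} = ((l ++ [A] : List LF) : Multiset LF) := by
  rw [← Multiset.coe_add]; rfl

theorem coe_snoc2 (l : List LF) (A B : LF) :
    (l : Multiset LF) + {A} + {B} = ((l ++ [A, B] : List LF) : Multiset LF) := by
  rw [coe_snoc, coe_snoc]; simp

namespace mLLJ

variable {s t : Multiset LF} {A B C : LF}

theorem id : mLLJ {A} A := ⟨[A], rfl, LLJ.id⟩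

theorem cut (h1 : mLLJ s B) (h2 : mLLJ (t + {B}) C) : mLLJ (t + s) C := by
  rw [add_comm]
  induction s using Quotient.inductionOn
  induction t using Quotient.inductionOn
  simp only [Multiset.quot_mk_to_coe, coe_snoc, Multiset.coe_add, mLLJ_coe] at *
  exact LLJ.cut h1 h2

theorem topL (h : mLLJ s C) : mLLJ (s + {LF.top}) C := by
  induction s using Quotient.inductionOn
  simp only [Multiset.quot_mk_to_coe, coe_snoc, mLLJ_coe] at *
  exact LLJ.topL h

theorem topR : mLLJ 0 LF.top := ⟨[], rfl, LLJ.topR⟩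

theorem tensorL (h : mLLJ (s + {A} + {B}) C) : mLLJ (s + {LF.tensor A B}) C := by
  induction s using Quotient.inductionOn
  rw [Multiset.quot_mk_to_coe, coe_snoc2, mLLJ_coe] at h
  simp only [Multiset.quot_mk_to_coe, coe_snoc, mLLJ_coe]
  exact LLJ.tensorL h

theorem tensorR (h1 : mLLJ s A) (h2 : mLLJ t B) : mLLJ (s + t) (LF.tensor A B) := by
  induction s using Quotient.inductionOn
  induction t using Quotient.inductionOn
  simp only [Multiset.quot_mk_to_coe, Multiset.coe_add, mLLJ_coe] at *
  exact LLJ.tensorR h1 h2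

theorem withL₁ (h : mLLJ (s + {A}) C) : mLLJ (s + {LF.withc A B}) C := by
  induction s using Quotient.inductionOn
  simp only [Multiset.quot_mk_to_coe, coe_snoc, mLLJ_coe] at *
  exact LLJ.withL₁ h

theorem withL₂ (h : mLLJ (s + {B}) C) : mLLJ (s + {LF.withc A B}) C := by
  induction s using Quotient.inductionOn
  simp only [Multiset.quot_mk_to_coe, coe_snoc, mLLJ_coe] at *
  exact LLJ.withL₂ h

theorem withR (h1 : mLLJ s A) (h2 : mLLJ s B) : mLLJ s (LF.withc A B) := by
  induction s using Quotient.inductionOn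
  simp only [Multiset.quot_mk_to_coe, mLLJ_coe] at *
  exact LLJ.withR h1 h2

theorem plusL (h1 : mLLJ (s + {A}) C) (h2 : mLLJ (s + {B}) C) : mLLJ (s + {LF.plus A B}) C := by
  induction s using Quotient.inductionOn
  simp only [Multiset.quot_mk_to_coe, coe_snoc, mLLJ_coe] at *
  exact LLJ.plusL h1 h2

theorem plusR₁ (h : mLLJ s A) : mLLJ s (LF.plus A B) := by
  obtain ⟨l, rfl, d⟩ := h
  exact ⟨l, rfl, LLJ.plusR₁ d⟩

theorem plusR₂ (h : mLLJ s B) : mLLJ s (LF.plus A B) := by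
  obtain ⟨l, rfl, d⟩ := h
  exact ⟨l, rfl, LLJ.plusR₂ d⟩

theorem ocW (h : mLLJ s C) : mLLJ (s + {LF.ofc A}) C := by
  induction s using Quotient.inductionOn
  simp only [Multiset.quot_mk_to_coe, coe_snoc, mLLJ_coe] at *
  exact LLJ.ocW h

theorem ocC (h : mLLJ (s + {LF.ofc A} + {LF.ofc A}) C) : mLLJ (s + {LF.ofc A}) C := by
  induction s using Quotient.inductionOn
  rw [Multiset.quot_mk_to_coe, coe_snoc2, mLLJ_coe] at h
  simp only [Multiset.quot_mk_to_coe, coe_snoc, mLLJ_coe]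
  exact LLJ.ocC h

theorem ocD (h : mLLJ (s + {A}) C) : mLLJ (s + {LF.ofc A}) C := by
  induction s using Quotient.inductionOn
  simp only [Multiset.quot_mk_to_coe, coe_snoc, mLLJ_coe] at *
  exact LLJ.ocD h

theorem ocR (h : mLLJ (s.map LF.ofc) B) : mLLJ (s.map LF.ofc) (LF.ofc B) := by
  induction s using Quotient.inductionOn
  simp only [Multiset.quot_mk_to_coe, Multiset.map_coe, mLLJ_coe] at *
  exact LLJ.ocR h

theorem limpL (h1 : mLLJ s A) (h2 : mLLJ (t + {B}) C) :
    mLLJ (s + t + {LF.par (LF.neg A) B}) C := by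
  induction s using Quotient.inductionOn
  induction t using Quotient.inductionOn
  simp only [Multiset.quot_mk_to_coe, coe_snoc, Multiset.coe_add, mLLJ_coe] at *
  exact LLJ.limpL h1 h2

theorem limpR (h : mLLJ (s + {A}) B) : mLLJ s (LF.par (LF.neg A) B) := by
  induction s using Quotient.inductionOn
  simp only [Multiset.quot_mk_to_coe, coe_snoc, mLLJ_coe] at *
  exact LLJ.limpR h

theorem wk (h : mLLJ s C) (t : Multiset LF) : mLLJ (s + t.map LF.ofc) C := by
  induction t using Multiset.induction_on with
  | empty => simpa using h
  | cons a t ih =>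
    have := ocW (A := a) ih
    rw [add_assoc, add_comm _ ({LF.ofc a} : Multiset LF)] at this
    simpa using this

theorem contr (t : Multiset LF) : ∀ s : Multiset LF,
    mLLJ (s + t.map LF.ofc + t.map LF.ofc) C → mLLJ (s + t.map LF.ofc) C := by
  induction t using Multiset.induction_on with
  | empty => intro s h; simpa using h
  | cons a t ih =>
    intro s h
    simp only [← Multiset.singleton_add, Multiset.map_add, Multiset.map_singleton] at *
    have h1 : mLLJ ((s + t.map LF.ofc + t.map LF.ofc) + {LF.ofc a} + {LF.ofc a}) C := by
      convert h using 1; abel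
    have h2 := ocC h1
    have h3 := ih (s + {LF.ofc a}) (by convert h2 using 1; abel)
    convert h3 using 1; abel

end mLLJ

/-! ### The phase space -/

abbrev PM := Multiset LF × Multiset LF

def pole : Set PM := {x | ∃ B, x.2 = {B} ∧ mLLJ x.1 B}

def perp (X : Set PM) : Set PM := {y | ∀ x ∈ X, x + y ∈ pole}

/-- The submonoid of elements of the form `!Δ ⊢`. -/
def KK : Set PM := {x | ∃ t : Multiset LF, x = (t.map LF.ofc, 0)}

def bang (X : Set PM) : Set PM := perp (perp (X ∩ KK))

theorem add_sub_pole {X Y : Set PM} : X + Y ⊆ pole ↔ X ⊆ perp Y := by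
  constructor
  · intro h x hx y hy
    rw [add_comm]; exact h (Set.add_mem_add hx hy)
  · rintro h _ ⟨x, hx, y, hy, rfl⟩
    have := h hx y hy
    rw [add_comm] at this; exact this

theorem sub_pp (X : Set PM) : X ⊆ perp (perp X) := by
  rw [← add_sub_pole, add_comm, add_sub_pole]

theorem perp_anti {X Y : Set PM} (h : X ⊆ Y) : perp Y ⊆ perp X := fun _ hy x hx => hy x (h hx)

theorem ppp (X : Set PM) : perp (perp (perp X)) = perp X :=
  Set.Subset.antisymm (perp_anti (sub_pp X)) (sub_pp _)

theorem add_pp_sub {G X : Set PM} : G + perp (perp X) ⊆ pole ↔ G + X ⊆ pole := by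
  rw [add_sub_pole, ppp, ← add_sub_pole]

theorem pole_eq : pole = perp {0} := by
  ext x; simp [perp]

theorem pole_cl : perp (perp pole) = pole := by rw [pole_eq, ppp]

theorem KK_add {x y : PM} (hx : x ∈ KK) (hy : y ∈ KK) : x + y ∈ KK := by
  obtain ⟨s, rfl⟩ := hx
  obtain ⟨t, rfl⟩ := hy
  exact ⟨s + t, by simp⟩

theorem KK_wk {x y : PM} (hx : x ∈ pole) (hy : y ∈ KK) : x + y ∈ pole := by
  obtain ⟨t, rfl⟩ := hy
  obtain ⟨B, h1, h2⟩ := hx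
  exact ⟨B, by simpa using h1, h2.wk t⟩

theorem KK_contr {x y : PM} (hy : y ∈ KK) (hx : x + y + y ∈ pole) : x + y ∈ pole := by
  obtain ⟨t, rfl⟩ := hy
  obtain ⟨B, h1, h2⟩ := hx
  exact ⟨B, by simpa using h1, mLLJ.contr t _ h2⟩

theorem bang_wk {G X : Set PM} (h : G ⊆ pole) : G + bang X ⊆ pole := by
  rw [bang, add_pp_sub]
  rintro _ ⟨g, hg, k, hk, rfl⟩
  exact KK_wk (h hg) hk.2

theorem bang_contr {G X : Set PM} (h : G + bang X + bang X ⊆ pole) : G + bang X ⊆ pole := by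
  rw [bang, add_pp_sub]
  rintro _ ⟨g, hg, k, hk, rfl⟩
  exact KK_contr hk.2
    (h (Set.add_mem_add (Set.add_mem_add hg (sub_pp _ hk)) (sub_pp _ hk)))

theorem bang_der {G X : Set PM} (h : G + X ⊆ pole) : G + bang X ⊆ pole := by
  rw [bang, add_pp_sub]
  exact (Set.add_subset_add_left Set.inter_subset_left).trans h

theorem bang_sum {ι : Type} (f : ι → Set PM) (L : List ι) : ∀ G : Set PM,
    G + (L.map fun X => bang (f X)).sum ⊆ pole ↔ G + (L.map fun X => f X ∩ KK).sum ⊆ pole := by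
  induction L with
  | nil => intro G; rfl
  | cons X L ih =>
    intro G
    simp only [List.map_cons, List.sum_cons]
    rw [← add_assoc, ih, add_right_comm, bang, add_pp_sub, add_right_comm, add_assoc]

theorem sum_KK {ι : Type} (f : ι → Set PM) (L : List ι) :
    (L.map fun X => f X ∩ KK).sum ⊆ KK := by
  induction L with
  | nil =>
    rintro x hx
    have : x = 0 := hx
    exact ⟨0, by rw [this]; rfl⟩
  | cons X L ih =>
    simp only [List.map_cons, List.sum_cons]
    rintro _ ⟨x, hx, y, hy, rfl⟩
    exact KK_add hx.2 (ih hy)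

theorem bang_prom {ι κ : Type} (f : ι → Set PM) (g : κ → Set PM) (L : List ι) (L' : List κ)
    {Z : Set PM} (hZ : perp (perp Z) = Z)
    (h : (L.map fun X => bang (f X)).sum + (L'.map fun X => bang (g X)).sum + perp Z ⊆ pole) :
    (L.map fun X => bang (f X)).sum + (L'.map fun X => bang (g X)).sum + perp (bang Z) ⊆ pole := by
  have key : ∀ G : Set PM,
      (L.map fun X => bang (f X)).sum + (L'.map fun X => bang (g X)).sum + G ⊆ pole ↔
      (L.map fun X => f X ∩ KK).sum + (L'.map fun X => g X ∩ KK).sum + G ⊆ pole := by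
    intro G
    rw [add_comm, ← add_assoc, bang_sum, add_right_comm, bang_sum]
    rw [add_assoc, add_comm, add_comm (List.sum _) (List.sum _)]
  rw [key] at *
  rw [add_sub_pole, hZ] at h
  rw [bang, ppp, add_sub_pole]
  refine Set.Subset.trans ?_ (sub_pp _)
  refine Set.subset_inter h ?_
  rintro _ ⟨x, hx, y, hy, rfl⟩
  exact KK_add (sum_KK _ _ hx) (sum_KK _ _ hy)

/-- Interpretation of formulas in the phase space. -/
def II : LF → Set PM
  | LF.var n => perp {((0 : Multiset LF), ({LF.var n} : Multiset LF))}
  | LF.top => perp pole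
  | LF.bot => pole
  | LF.one => Set.univ
  | LF.zero => perp Set.univ
  | LF.tensor A B => perp (perp (II A + II B))
  | LF.par A B => perp (perp (II A) + perp (II B))
  | LF.withc A B => II A ∩ II B
  | LF.plus A B => perp (perp (II A ∪ II B))
  | LF.neg A => perp (II A)
  | LF.ofc A => bang (II A)
  | LF.wn A => perp (bang (perp (II A)))

theorem inter_cl {X Y : Set PM} (hX : perp (perp X) = X) (hY : perp (perp Y) = Y) :
    perp (perp (X ∩ Y)) = X ∩ Y := by
  apply Set.Subset.antisymm _ (sub_pp _)
  apply Set.subset_inter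
  · exact (perp_anti (perp_anti Set.inter_subset_left)).trans hX.subset
  · exact (perp_anti (perp_anti Set.inter_subset_right)).trans hY.subset

theorem II_cl (A : LF) : perp (perp (II A)) = II A := by
  induction A with
  | withc A B hA hB => exact inter_cl hA hB
  | bot => exact pole_cl
  | one => exact Set.Subset.antisymm (Set.subset_univ _) (sub_pp _)
  | _ => simp only [II, bang, ppp]

def JJ (A : LF) : Set PM := perp (II A)

theorem perp_JJ (A : LF) : perp (JJ A) = II A := II_cl A

theorem JJ_wn (A : LF) : JJ (LF.wn A) = bang (JJ A) := by simp only [JJ, II, bang, ppp]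

def EE (Δ Γ : List LF) : Set PM := (Δ.map II).sum + (Γ.map JJ).sum

theorem tr {X Y : Set PM} (h : X ⊆ pole) (e : Y = X) : Y ⊆ pole := e ▸ h

theorem EE_l (Δ Γ : List LF) (A : LF) : EE (Δ ++ [A]) Γ = EE Δ Γ + II A := by
  simp only [EE, List.map_append, List.sum_append, List.map_cons, List.sum_cons, List.map_nil,
    List.sum_nil, add_zero]; abel

theorem EE_l2 (Δ Γ : List LF) (A B : LF) : EE (Δ ++ [A, B]) Γ = EE Δ Γ + II A + II B := by
  simp only [EE, List.map_append, List.sum_append, List.map_cons, List.sum_cons, List.map_nil,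
    List.sum_nil, add_zero]; abel

theorem EE_r (Δ Γ : List LF) (A : LF) : EE Δ (A :: Γ) = EE Δ Γ + JJ A := by
  simp only [EE, List.map_cons, List.sum_cons]; abel

theorem EE_add (Δ Δ' Γ Γ' : List LF) : EE (Δ ++ Δ') (Γ ++ Γ') = EE Δ Γ + EE Δ' Γ' := by
  simp only [EE, List.map_append, List.sum_append]; abel

theorem EE_bang (Δ Γ : List LF) : EE (List.map LF.ofc Δ) (List.map LF.wn Γ) =
    (Δ.map fun A => bang (II A)).sum + (Γ.map fun A => bang (JJ A)).sum := by
  simp only [EE, List.map_map]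
  congr 3
  funext A
  exact JJ_wn A

theorem sound {c w : Bool} {Δ Γ : List LF} (h : ILC c w Δ Γ) (hw : w = false) :
    EE Δ Γ ⊆ pole := by
  induction h with
  | xl _ ih =>
    refine tr (ih hw) ?_
    simp only [EE, List.map_append, List.sum_append, List.map_cons, List.sum_cons]; abel
  | xr _ ih =>
    refine tr (ih hw) ?_
    simp only [EE, List.map_append, List.sum_append, List.map_cons, List.sum_cons]; abel
  | ocW _ ih => rw [EE_l]; exact bang_wk (ih hw)
  | wnW _ ih => rw [EE_r, JJ_wn]; exact bang_wk (ih hw)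
  | ocC _ ih => rw [EE_l2] at ih; rw [EE_l]; exact bang_contr (ih hw)
  | wnC _ ih => rw [EE_r, EE_r, JJ_wn] at ih; rw [EE_r, JJ_wn]; exact bang_contr (ih hw)
  | ocD _ ih => rw [EE_l] at *; exact bang_der (ih hw)
  | wnD _ ih => rw [EE_r] at *; rw [JJ_wn]; exact bang_der (ih hw)
  | @wnL _ _ _ A _ _ ih =>
    rw [EE_l, EE_bang] at *
    refine bang_prom II JJ _ _ (Z := JJ A) (by rw [JJ, ppp]) ?_
    rw [perp_JJ]; exact ih hw
  | ocR _ ih =>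
    rw [EE_r, EE_bang] at *
    exact bang_prom II JJ _ _ (II_cl _) (ih hw)
  | @id _ _ A =>
    have : EE [A] [A] = II A + JJ A := by simp [EE]
    rw [this, add_comm, add_sub_pole]; rfl
  | cut _ _ ih1 ih2 =>
    rw [EE_l] at ih2
    rw [EE_r] at ih1
    rw [EE_add]
    have h1 := ih1 hw
    rw [add_sub_pole, perp_JJ] at h1
    rw [add_comm]
    exact (Set.add_subset_add_left h1).trans (ih2 hw)
  | oneR =>
    rw [EE_r, add_sub_pole, perp_JJ]; exact Set.subset_univ _
  | zeroL =>
    rw [EE_l, II, add_pp_sub.symm, ppp, add_sub_pole]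
    exact (Set.subset_univ _).trans (sub_pp _)
  | topL _ ih =>
    rw [EE_l, II, add_sub_pole]
    exact (ih hw).trans (sub_pp _)
  | topR =>
    have : EE [] [LF.top] = JJ LF.top := by simp [EE]
    rw [this, JJ, II, pole_cl]
  | botL =>
    have : EE [LF.bot] [] = II LF.bot := by simp [EE]
    rw [this, II]
  | botR _ ih =>
    rw [EE_r, add_sub_pole, perp_JJ]
    exact ih hw
  | tensorL _ ih =>
    rw [EE_l2] at ih
    rw [EE_l, II, add_pp_sub, ← add_assoc]
    exact ih hw
  | tensorR _ _ ih1 ih2 =>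
    rw [EE_r, EE_add]
    rw [EE_r, add_sub_pole, perp_JJ] at ih1 ih2
    rw [add_sub_pole, perp_JJ, II]
    exact (Set.add_subset_add (ih1 hw) (ih2 hw)).trans (sub_pp _)
  | withL₁ _ ih =>
    rw [EE_l] at *
    exact (Set.add_subset_add_left Set.inter_subset_left).trans (ih hw)
  | withL₂ _ ih =>
    rw [EE_l] at *
    exact (Set.add_subset_add_left Set.inter_subset_right).trans (ih hw)
  | withR _ _ ih1 ih2 =>
    rw [EE_r, add_sub_pole, perp_JJ] at *
    exact Set.subset_inter (ih1 hw) (ih2 hw)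
  | @parL _ _ Δ₁ A₁ Γ₁ Δ₂ A₂ Γ₂ _ _ ih1 ih2 =>
    rw [EE_l, EE_add, II, add_sub_pole]
    rw [EE_l, add_sub_pole] at ih1 ih2
    exact (Set.add_subset_add (ih1 hw) (ih2 hw)).trans (sub_pp _)
  | parR _ ih =>
    rw [EE_r, EE_r] at ih
    rw [EE_r, JJ, II, add_pp_sub, ← add_assoc, add_right_comm]
    exact ih hw
  | plusL _ _ ih1 ih2 =>
    rw [EE_l] at *
    rw [II, add_pp_sub, Set.add_union]
    exact Set.union_subset (ih1 hw) (ih2 hw)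
  | plusR₁ _ ih =>
    rw [EE_r, add_sub_pole, perp_JJ] at *
    exact (ih hw).trans (Set.subset_union_left.trans (sub_pp _))
  | plusR₂ _ ih =>
    rw [EE_r, add_sub_pole, perp_JJ] at *
    exact (ih hw).trans (Set.subset_union_right.trans (sub_pp _))
  | negL _ ih =>
    rw [EE_r] at ih
    rw [EE_l]; exact ih hw
  | negR _ ih =>
    rw [EE_l] at ih
    rw [EE_r, JJ, II, II_cl]; exact ih hw
  | ocwnL _ _ => cases hw
  | wnocR _ _ => cases hw

/-! ### ILL formulas are interpreted by provability -/

def LL (A : LF) : Set PM := {(({A} : Multiset LF), (0 : Multiset LF))}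
def RR (A : LF) : Set PM := {((0 : Multiset LF), ({A} : Multiset LF))}

theorem mem_perp_RR {A : LF} {x : PM} : x ∈ perp (RR A) ↔ x.2 = 0 ∧ mLLJ x.1 A := by
  obtain ⟨s, t⟩ := x
  simp only [perp, RR, pole, Set.mem_ofPred_eq, Set.mem_singleton_iff, forall_eq, Prod.fst_add,
    Prod.snd_add, zero_add]
  constructor
  · rintro ⟨B, h1, h2⟩
    have ht : t = 0 := by
      have := congrArg Multiset.card h1
      simpa using this
    subst ht
    have : A = B := by simpa using h1
    subst this
    exact ⟨rfl, h2⟩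
  · rintro ⟨rfl, h⟩
    exact ⟨A, by simp, h⟩

theorem mem_perp_LL {A : LF} {x : PM} :
    x ∈ perp (LL A) ↔ ∃ B, x.2 = {B} ∧ mLLJ (x.1 + {A}) B := by
  simp only [perp, LL, pole, Set.mem_ofPred_eq, Set.mem_singleton_iff, forall_eq, Prod.fst_add,
    Prod.snd_add, add_comm, add_zero]

theorem pp_LL (A : LF) : perp (perp (LL A)) = perp (RR A) := by
  apply Set.Subset.antisymm
  · apply perp_anti
    rintro _ rfl
    rw [mem_perp_LL]
    exact ⟨A, rfl, by simpa using mLLJ.id⟩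
  · intro x hx y hy
    rw [mem_perp_RR] at hx
    rw [mem_perp_LL] at hy
    obtain ⟨B, h1, h2⟩ := hy
    exact ⟨B, by simp [h1, hx.1], mLLJ.cut hx.2 h2⟩

/-- It suffices to compare orthogonals. -/
theorem pp_of_perp {X : Set PM} {A : LF} (h : perp X = perp (LL A)) :
    perp (perp X) = perp (RR A) := by rw [h, pp_LL]

theorem LL_mem (A : LF) : (({A} : Multiset LF), (0 : Multiset LF)) ∈ perp (RR A) :=
  mem_perp_RR.2 ⟨rfl, mLLJ.id⟩

theorem II_ILL {A : LF} (h : IsILL A) : II A = perp (RR A) := by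
  induction h with
  | var n => rfl
  | top =>
    ext ⟨s, t⟩
    rw [mem_perp_RR, II]
    constructor
    · intro h
      have := h ((0 : Multiset LF), ({LF.top} : Multiset LF)) ⟨_, rfl, mLLJ.topR⟩
      exact (mem_perp_RR (A := LF.top)).1 (fun x hx => by cases hx; exact this)
    · rintro ⟨h1, h2⟩ ⟨s', t'⟩ ⟨B, h3, h4⟩
      exact ⟨B, by simp_all, mLLJ.cut h2 (mLLJ.topL h4)⟩
  | @tensor A B _ _ ihA ihB =>
    rw [II, ihA, ihB]
    apply pp_of_perp
    ext ⟨s, t⟩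
    rw [mem_perp_LL]
    constructor
    · intro h
      obtain ⟨C, h1, h2⟩ := h _ (Set.add_mem_add (LL_mem A) (LL_mem B))
      refine ⟨C, by simpa using h1, mLLJ.tensorL ?_⟩
      convert h2 using 1
      simp only [Prod.fst_add]; abel
    · rintro ⟨C, h1, h2⟩ _ ⟨x, hx, y, hy, rfl⟩
      simp only [mem_perp_RR] at hx hy
      refine ⟨C, by simp_all, ?_⟩
      have := mLLJ.cut (mLLJ.tensorR hx.2 hy.2) h2
      simpa [add_comm] using this
  | @withc A B _ _ ihA ihB =>
    rw [II, ihA, ihB]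
    ext x
    simp only [Set.mem_inter_iff, mem_perp_RR]
    constructor
    · rintro ⟨⟨h, h1⟩, ⟨_, h2⟩⟩
      exact ⟨h, h1.withR h2⟩
    · rintro ⟨h, h1⟩
      refine ⟨⟨h, ?_⟩, h, ?_⟩
      · have := mLLJ.cut h1 (t := 0) (C := A) (mLLJ.withL₁ (by simpa using mLLJ.id))
        simpa using this
      · have := mLLJ.cut h1 (t := 0) (C := B) (mLLJ.withL₂ (by simpa using mLLJ.id))
        simpa using this
  | @plus A B _ _ ihA ihB =>
    rw [II, ihA, ihB]
    apply pp_of_perp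
    ext ⟨s, t⟩
    rw [mem_perp_LL]
    constructor
    · intro h
      obtain ⟨C, h1, h2⟩ := h _ (Or.inl (LL_mem A))
      obtain ⟨C', h1', h2'⟩ := h _ (Or.inr (LL_mem B))
      simp only [Prod.fst_add, Prod.snd_add, zero_add] at *
      have : C = C' := by simpa using h1.symm.trans h1'
      subst this
      rw [add_comm] at h2 h2'
      exact ⟨C, h1, mLLJ.plusL h2 h2'⟩
    · rintro ⟨C, h1, h2⟩ x hx
      have hx' : x.2 = 0 ∧ mLLJ x.1 (LF.plus A B) := by
        rcases hx with hx | hx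
        · rw [mem_perp_RR] at hx; exact ⟨hx.1, hx.2.plusR₁⟩
        · rw [mem_perp_RR] at hx; exact ⟨hx.1, hx.2.plusR₂⟩
      refine ⟨C, by simp_all, ?_⟩
      have := mLLJ.cut hx'.2 h2
      simpa [add_comm] using this
  | @limp A B _ _ ihA ihB =>
    rw [II, II, ihA, ihB, ppp, ← pp_LL B, ppp]
    ext ⟨s, t⟩
    rw [mem_perp_RR]
    constructor
    · intro h
      have hB : ((0 : Multiset LF), ({B} : Multiset LF)) ∈ perp (LL B) :=
        mem_perp_LL.2 ⟨B, rfl, by simpa using mLLJ.id⟩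
      have := h _ (Set.add_mem_add (LL_mem A) hB)
      have h3 : (({A} : Multiset LF) + s, t) ∈ perp (RR B) := by
        rintro _ rfl
        simpa using this
      rw [mem_perp_RR] at h3
      exact ⟨h3.1, mLLJ.limpR (by rw [add_comm]; exact h3.2)⟩
    · rintro ⟨h1, h2⟩ _ ⟨x, hx, y, hy, rfl⟩
      simp only [mem_perp_RR] at hx
      obtain ⟨C, h3, h4⟩ := mem_perp_LL.1 hy
      exact ⟨C, by simp_all, mLLJ.cut h2 (mLLJ.limpL hx.2 h4)⟩
  | @ofc A _ ihA =>
    rw [II, ihA, bang]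
    apply pp_of_perp
    ext ⟨s, t⟩
    rw [mem_perp_LL]
    constructor
    · intro h
      obtain ⟨C, h1, h2⟩ := h (({LF.ofc A} : Multiset LF), (0 : Multiset LF))
        ⟨mem_perp_RR.2 ⟨rfl, by
          have := mLLJ.ocD (s := 0) (A := A) (C := A) (by simpa using mLLJ.id)
          simpa using this⟩, ⟨{A}, rfl⟩⟩
      refine ⟨C, by simpa using h1, ?_⟩
      rw [add_comm]; exact h2
    · rintro ⟨C, h1, h2⟩ _ ⟨hx, ⟨u, rfl⟩⟩
      rw [mem_perp_RR] at hx
      refine ⟨C, by simp_all, ?_⟩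
      have := mLLJ.cut (mLLJ.ocR hx.2) h2
      simpa [add_comm] using this

theorem sum_L (Δ : List LF) (h : ∀ A ∈ Δ, IsILL A) :
    ((Δ : Multiset LF), (0 : Multiset LF)) ∈ (Δ.map II).sum := by
  induction Δ with
  | nil => exact Set.mem_zero.2 rfl
  | cons A Δ ih =>
    have hA : (({A} : Multiset LF), (0 : Multiset LF)) ∈ II A := by
      rw [II_ILL (h A (by simp))]; exact LL_mem A
    have := Set.add_mem_add hA (ih fun B hB => h B (by simp [hB]))
    simpa using this

theorem sum_R (Γ : List LF) (h : ∀ A ∈ Γ, IsILL A) :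
    ((0 : Multiset LF), (Γ : Multiset LF)) ∈ (Γ.map JJ).sum := by
  induction Γ with
  | nil => exact Set.mem_zero.2 rfl
  | cons A Γ ih =>
    have hA : ((0 : Multiset LF), ({A} : Multiset LF)) ∈ JJ A := by
      rw [JJ, II_ILL (h A (by simp))]; exact sub_pp _ rfl
    have := Set.add_mem_add hA (ih fun B hB => h B (by simp [hB]))
    simpa using this

/-- ILC is a conservative extension of LLJ: every sequent provable in LLJ is
provable in ILC, and any ILC-provable sequent built only from ILL-formulas has
a right-hand side of length at most one and is provable in LLJ. -/
theorem ilc_conservative_over_llj :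
    (∀ (Δ : List LF) (C : Option LF), LLJ Δ C → ILC true false Δ C.toList) ∧
    (∀ (Δ Γ : List LF), (∀ A ∈ Δ, IsILL A) → (∀ A ∈ Γ, IsILL A) →
        ILC true false Δ Γ →
        (Γ = [] ∧ LLJ Δ none) ∨ (∃ B, Γ = [B] ∧ LLJ Δ (some B))) := by
  refine ⟨fun Δ C h => h.to_ilc, fun Δ Γ hΔ hΓ h => Or.inr ?_⟩
  obtain ⟨B, h1, h2⟩ := sound h rfl (Set.add_mem_add (sum_L Δ hΔ) (sum_R Γ hΓ))
  simp only [Prod.fst_add, Prod.snd_add, zero_add, add_zero] at h1 h2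
  refine ⟨B, ?_, mLLJ_coe.1 h2⟩
  exact Multiset.coe_eq_singleton.1 h1
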